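/- arXiv:2407.10350 — 3 statements merged into one kernel-verified Lean document; each statement's English description precedes it below -/
import Mathlib

section
/- Let x, y, z ∈ H, let (p_k)_{k≥0} and (q_k)_{k≥0} be sequences of positive reals, and for each k ≥ 1 let z_k* ∈ ∂F_k(z) be a subgradient of F_k at z. Then for all k ≥ 1: (p_k + q_k)F_k(x) − p_k F_k(y) − q_k F_k(z) ≥ (p_k + q_k)(F_{k+1}(x) − F_{k+1}(x̄_{k+1})) − (p_{k−1} + q_{k−1})(F_k(y) − F_k(x̄_k)) + (p_{k−1} + q_{k−1} − p_k)(F_k(y) − F_k(x̄_k)) + (p_k + q_k)((ε_{k+1} − ε_k)/2)‖x̄_{k+1}‖² + q_k ⟨z_k*, x̄_{k+1} − z⟩ + p_k (ε_k/2)‖x̄_{k+1} − x̄_k‖² + q_k (ε_k/2)‖x̄_{k+1} − z‖². -/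
open Filter Topology
open scoped RealInnerProductSpace

/-- If `A ≤ B + t * C` holds for all `t ∈ (0, 1)`, then letting `t` tend to zero gives `A ≤ B`. -/
lemma le_of_forall_mem_Ioo_le_add_mul {A B C : ℝ}
    (h : ∀ t : ℝ, 0 < t → t < 1 → A ≤ B + t * C) : A ≤ B := by
  have hlim : Tendsto (fun t : ℝ => B + t * C) (𝓝[>] 0) (𝓝 B) := by
    have hc : Continuous fun t : ℝ => B + t * C := by fun_prop
    simpa using (hc.tendsto 0).mono_left nhdsWithin_le_nhds
  refine ge_of_tendsto hlim ?_
  filter_upwards [Ioo_mem_nhdsGT (zero_lt_one' ℝ)] with t ht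
  exact h t ht.1 ht.2

lemma norm_sq_convex_combination {H : Type*} [NormedAddCommGroup H] [InnerProductSpace ℝ H]
    (z w : H) (t : ℝ) :
    ‖(1 - t) • z + t • w‖ ^ 2
      = (1 - t) * ‖z‖ ^ 2 + t * ‖w‖ ^ 2 - t * (1 - t) * ‖w - z‖ ^ 2 := by
  rw [norm_add_sq_real, norm_sub_sq_real, norm_smul, norm_smul, mul_pow, mul_pow,
    inner_smul_left, inner_smul_right, Real.norm_eq_abs, Real.norm_eq_abs, sq_abs, sq_abs,
    real_inner_comm]
  simp only [conj_trivial]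
  ring

/-- A subgradient of `f + g + (c / 2) ‖·‖²` at a point `z` of the domain satisfies the
strengthened subgradient inequality of a `c`-strongly convex function. -/
lemma strong_subgradient_inequality
    {H : Type*} [NormedAddCommGroup H] [InnerProductSpace ℝ H]
    {f : H → EReal}
    (hf_convex : ∀ u v : H, ∀ a b : ℝ, 0 ≤ a → 0 ≤ b → a + b = 1 →
      f (a • u + b • v) ≤ (a : EReal) * f u + (b : EReal) * f v)
    {g : H → ℝ} (hg_convex : ConvexOn ℝ Set.univ g) {c : ℝ} {z v : H}
    (hv : ∀ w : H, f z + (g z : EReal) + ((c / 2 * ‖z‖ ^ 2 : ℝ) : EReal)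
      + ((⟪v, w - z⟫ : ℝ) : EReal) ≤ f w + (g w : EReal) + ((c / 2 * ‖w‖ ^ 2 : ℝ) : EReal))
    {w : H} {a b : ℝ} (ha : f z = a) (hb : f w = b) :
    a + g z + c / 2 * ‖z‖ ^ 2 + ⟪v, w - z⟫ + c / 2 * ‖w - z‖ ^ 2
      ≤ b + g w + c / 2 * ‖w‖ ^ 2 := by
  refine le_of_forall_mem_Ioo_le_add_mul (C := c / 2 * ‖w - z‖ ^ 2) fun t ht0 ht1 => ?_
  have hfc := hf_convex z w (1 - t) t (by linarith) ht0.le (by ring)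
  have hgc := hg_convex.2 (Set.mem_univ z) (Set.mem_univ w)
    (by linarith : 0 ≤ 1 - t) ht0.le (by ring)
  have hs := hv ((1 - t) • z + t • w)
  rw [norm_sq_convex_combination] at hs
  have hsub : (1 - t) • z + t • w - z = t • (w - z) := by module
  rw [hsub, inner_smul_right, ha] at hs
  rw [ha, hb] at hfc
  have hle := hs.trans (add_le_add_left (add_le_add_left hfc _) _)
  norm_cast at hle
  simp only [smul_eq_mul] at hgc
  refine le_of_mul_le_mul_left ?_ ht0
  linarith

/-- Lemma B.1 (forleftside): key inequality making telescoping possible. -/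
theorem forleftside_inequality
    {H : Type*} [NormedAddCommGroup H] [InnerProductSpace ℝ H] [CompleteSpace H]
    (f : H → EReal)
    (hf_proper : ∃ z, f z ≠ ⊤) (hf_nebot : ∀ z, f z ≠ ⊥)
    (hf_convex : ∀ u v : H, ∀ a b : ℝ, 0 ≤ a → 0 ≤ b → a + b = 1 →
      f (a • u + b • v) ≤ (a : EReal) * f u + (b : EReal) * f v)
    (hf_lsc : LowerSemicontinuous f)
    (g : H → ℝ) (g' : H → H) (L : ℝ) (hL : 0 < L)
    (hg_convex : ConvexOn ℝ Set.univ g)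
    (hg_diff : ∀ u : H, HasGradientAt g (g' u) u)
    (hg_lip : ∀ u v : H, ‖g' u - g' v‖ ≤ L * ‖u - v‖)
    -- (ε_k) is a nonincreasing sequence of positive reals
    (ε : ℕ → ℝ) (hε_pos : ∀ k : ℕ, 1 ≤ k → 0 < ε k)
    (hε_anti : ∀ k : ℕ, 1 ≤ k → ε (k + 1) ≤ ε k)
    -- F_k(x) = f(x) + g(x) + (ε_k/2)‖x‖² and its unique minimizer x̄_k
    (F : ℕ → H → EReal)
    (hF : ∀ (k : ℕ) (u : H), F k u = f u + (g u : EReal) + ((ε k / 2 * ‖u‖ ^ 2 : ℝ) : EReal))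
    (xbar : ℕ → H)
    (hxbar : ∀ (k : ℕ) (u : H), F k (xbar k) ≤ F k u)
    -- the points, the positive sequences and the subgradients z_k* of F_k at z
    (x y z : H)
    (p q : ℕ → ℝ) (hp : ∀ k : ℕ, 0 < p k) (hq : ∀ k : ℕ, 0 < q k)
    (zstar : ℕ → H)
    (hzstar : ∀ k : ℕ, 1 ≤ k → ∀ w : H,
      F k z + ((⟪zstar k, w - z⟫ : ℝ) : EReal) ≤ F k w) :
    ∀ k : ℕ, 1 ≤ k →
      ((p k + q k : ℝ) : EReal) * F k x - ((p k : ℝ) : EReal) * F k y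
          - ((q k : ℝ) : EReal) * F k z
        ≥ ((p k + q k : ℝ) : EReal) * (F (k + 1) x - F (k + 1) (xbar (k + 1)))
          - ((p (k - 1) + q (k - 1) : ℝ) : EReal) * (F k y - F k (xbar k))
          + ((p (k - 1) + q (k - 1) - p k : ℝ) : EReal) * (F k y - F k (xbar k))
          + (((p k + q k) * ((ε (k + 1) - ε k) / 2) * ‖xbar (k + 1)‖ ^ 2 : ℝ) : EReal)
          + ((q k * ⟪zstar k, xbar (k + 1) - z⟫ : ℝ) : EReal)
          + ((p k * (ε k / 2) * ‖xbar (k + 1) - xbar k‖ ^ 2 : ℝ) : EReal)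
          + ((q k * (ε k / 2) * ‖xbar (k + 1) - z‖ ^ 2 : ℝ) : EReal) := by
  intro k hk
  obtain ⟨d, hd⟩ := hf_proper
  have real_of_ne_top : ∀ u, f u ≠ ⊤ → ∃ r : ℝ, f u = r := fun u hu =>
    ⟨(f u).toReal, (EReal.coe_toReal hu (hf_nebot u)).symm⟩
  obtain ⟨fd, hfd⟩ := real_of_ne_top d hd
  have subgradient_xbar : ∀ (j : ℕ) (w : H), f (xbar j) + (g (xbar j) : EReal)
      + ((ε j / 2 * ‖xbar j‖ ^ 2 : ℝ) : EReal) + ((⟪(0 : H), w - xbar j⟫ : ℝ) : EReal)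
      ≤ f w + (g w : EReal) + ((ε j / 2 * ‖w‖ ^ 2 : ℝ) : EReal) := fun j w => by
    simpa only [hF, inner_zero_left, EReal.coe_zero, add_zero] using hxbar j w
  have subgradient_z := hzstar k hk
  simp only [hF] at subgradient_z
  have ne_top_of_subgradient : ∀ (j : ℕ) (u v : H), f u + (g u : EReal)
      + ((ε j / 2 * ‖u‖ ^ 2 : ℝ) : EReal) + ((⟪v, d - u⟫ : ℝ) : EReal)
      ≤ f d + (g d : EReal) + ((ε j / 2 * ‖d‖ ^ 2 : ℝ) : EReal) → f u ≠ ⊤ := by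
    intro j u v h htop
    rw [htop, hfd, EReal.top_add_coe, EReal.top_add_coe, EReal.top_add_coe] at h
    norm_cast at h
  obtain ⟨fz, hfz⟩ := real_of_ne_top z (ne_top_of_subgradient k z _ (subgradient_z d))
  obtain ⟨fm, hfm⟩ := real_of_ne_top _ (ne_top_of_subgradient k _ _ (subgradient_xbar k d))
  obtain ⟨fn, hfn⟩ := real_of_ne_top _
    (ne_top_of_subgradient (k + 1) _ _ (subgradient_xbar (k + 1) d))
  simp only [hF, ge_iff_le, hfz, hfm, hfn]
  by_cases hy : f y = ⊤
  · have hpq : 0 < p (k - 1) + q (k - 1) := add_pos (hp _) (hq _)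
    have hdiff : (⊤ : EReal) + (g y : EReal) + ((ε k / 2 * ‖y‖ ^ 2 : ℝ) : EReal)
        - ((fm : EReal) + (g (xbar k) : EReal) + ((ε k / 2 * ‖xbar k‖ ^ 2 : ℝ) : EReal)) = ⊤ := by
      rw [EReal.top_add_coe, EReal.top_add_coe]
      norm_cast
    rw [hy, hdiff, EReal.coe_mul_top_of_pos hpq, EReal.sub_top]
    simp only [EReal.bot_add, bot_le]
  obtain ⟨fy, hfy⟩ := real_of_ne_top y hy
  by_cases hx : f x = ⊤
  · have hpq : 0 < p k + q k := add_pos (hp _) (hq _)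
    have htop : ((p k + q k : ℝ) : EReal)
          * (f x + (g x : EReal) + ((ε k / 2 * ‖x‖ ^ 2 : ℝ) : EReal))
        - ((p k : ℝ) : EReal) * (f y + (g y : EReal) + ((ε k / 2 * ‖y‖ ^ 2 : ℝ) : EReal))
        - ((q k : ℝ) : EReal)
          * ((fz : EReal) + (g z : EReal) + ((ε k / 2 * ‖z‖ ^ 2 : ℝ) : EReal)) = ⊤ := by
      rw [hx, hfy, EReal.top_add_coe, EReal.top_add_coe, EReal.coe_mul_top_of_pos hpq]
      norm_cast
    rw [htop]
    exact le_top
  obtain ⟨fx, hfx⟩ := real_of_ne_top x hx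
  rw [hfx, hfy]
  norm_cast
  have hm := strong_subgradient_inequality hf_convex hg_convex (subgradient_xbar k) hfm hfn
  have hz := strong_subgradient_inequality hf_convex hg_convex subgradient_z hfz hfn
  rw [inner_zero_left] at hm
  have hm' := mul_le_mul_of_nonneg_left hm (hp k).le
  have hz' := mul_le_mul_of_nonneg_left hz (hq k).le
  have hx' : 0 ≤ (p k + q k) * ((ε k - ε (k + 1)) * ‖x‖ ^ 2) :=
    mul_nonneg (add_pos (hp k) (hq k)).le
      (mul_nonneg (sub_nonneg.mpr (hε_anti k hk)) (sq_nonneg _))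
  linarith
end

section
/- Let (t_k)_{k≥0} be a sequence of reals satisfying condition (T), let (x_k)_{k≥0} be any sequence in H, and for k ≥ 1 define y_k = x_k + ((t_k − 1)(t_{k−1} − 1)/t_{k−1}²)(x_k − x_{k−1}) − ((−t_k² + t_k + t_{k−1}²)/(t_{k−1}² t_k)) x_k and η_k = (t_{k−1}²/(t_k − 1)) y_k − (t_{k−1}²/t_k) x_k. Then for every x* ∈ H and all k ≥ 1: ⟨y_k − x_{k+1}, 2t_k² y_k − 2(t_k² − t_k) x_k − 2t_k x* − t_k²(y_k − x_{k+1})⟩ = ((t_k² − t_k)/t_{k−1}²)‖η_k − x*‖² − ‖η_{k+1} − x*‖² − ((t_k² − t_k)/t_{k−1}²)·((−t_k² + t_k + t_{k−1}²)/t_{k−1}²)‖η_k‖² + ((−t_k² + t_k + t_{k−1}²)/t_{k−1}²)‖x*‖². -/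
open Filter Topology
open scoped RealInnerProductSpace

/-- A strictly increasing sequence, stated through predecessors, stays above its first term. -/
lemma one_le_of_pred_lt {t : ℕ → ℝ} (ht0 : t 0 = 1)
    (hT : ∀ k : ℕ, 1 ≤ k → t (k - 1) < t k) (k : ℕ) : 1 ≤ t k := by
  induction k with
  | zero => exact ht0.ge
  | succ n ih => exact ih.trans (hT (n + 1) n.succ_pos).le

/-- In the recursion for `y`, the vector `η` collapses to an extrapolation of `x`. -/
lemma eta_eq_extrapolation {H : Type*} [AddCommGroup H] [Module ℝ H] {s t : ℝ}
    (hs : s ≠ 0) (ht : t ≠ 0) (ht1 : t - 1 ≠ 0) (x x' : H) :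
    (s ^ 2 / (t - 1)) • (x' + (((t - 1) * (s - 1)) / s ^ 2) • (x' - x)
        - ((-t ^ 2 + t + s ^ 2) / (s ^ 2 * t)) • x') - (s ^ 2 / t) • x'
      = s • x' - (s - 1) • x := by
  match_scalars <;> field_simp
  ring

/-- Expansion of the key inner product in terms of `e` and `e'`, where
`t • y - (t - 1) • x = a • e` and `e' = t • x' - (t - 1) • x`. -/
lemma inner_extrapolation_eq {H : Type*} [NormedAddCommGroup H] [InnerProductSpace ℝ H]
    {t a : ℝ} {x x' y e e' : H} (hy : t • y - (t - 1) • x = a • e)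
    (he' : e' = t • x' - (t - 1) • x) (z : H) :
    ⟪y - x', (2 * t ^ 2) • y - (2 * (t ^ 2 - t)) • x - (2 * t) • z - t ^ 2 • (y - x')⟫
      = a * ‖e - z‖ ^ 2 - ‖e' - z‖ ^ 2 - a * (1 - a) * ‖e‖ ^ 2 + (1 - a) * ‖z‖ ^ 2 := by
  have hd : t • (y - x') = a • e - e' := by
    rw [← hy, he']
    module
  have hv : (2 * t ^ 2) • y - (2 * (t ^ 2 - t)) • x - (2 * t) • z - t ^ 2 • (y - x')
      = t • (a • e + e' - (2 : ℝ) • z) := by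
    rw [← hy, he']
    module
  rw [hv, real_inner_smul_right, ← real_inner_smul_left, hd]
  simp only [← real_inner_self_eq_norm_sq, inner_sub_left, inner_sub_right, inner_add_right,
    real_inner_smul_left, real_inner_smul_right, real_inner_comm e e', real_inner_comm e z,
    real_inner_comm e' z]
  ring

/-- Lemma B.3 (foretandif): the key identity involving
`η_k = (t_{k−1}²/(t_k − 1)) y_k − (t_{k−1}²/t_k) x_k` and an arbitrary `x* ∈ H`. -/
theorem eta_identity
    {H : Type*} [NormedAddCommGroup H] [InnerProductSpace ℝ H]
    (t : ℕ → ℝ) (ht0 : t 0 = 1)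
    (hT : ∀ k : ℕ, 1 ≤ k →
      t (k - 1) < t k ∧ t k < (1 + Real.sqrt (1 + 4 * t (k - 1) ^ 2)) / 2)
    (x y η : ℕ → H)
    (hy : ∀ k : ℕ, 1 ≤ k → y k = x k
        + (((t k - 1) * (t (k - 1) - 1)) / (t (k - 1)) ^ 2) • (x k - x (k - 1))
        - (((-(t k) ^ 2 + t k + (t (k - 1)) ^ 2) / ((t (k - 1)) ^ 2 * t k))) • x k)
    (hη : ∀ k : ℕ, 1 ≤ k →
      η k = ((t (k - 1)) ^ 2 / (t k - 1)) • y k - ((t (k - 1)) ^ 2 / t k) • x k)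
    (xstar : H) :
    ∀ k : ℕ, 1 ≤ k →
      ⟪y k - x (k + 1),
        (2 * (t k) ^ 2) • y k - (2 * ((t k) ^ 2 - t k)) • x k - (2 * t k) • xstar
          - ((t k) ^ 2) • (y k - x (k + 1))⟫
      = ((t k) ^ 2 - t k) / (t (k - 1)) ^ 2 * ‖η k - xstar‖ ^ 2 - ‖η (k + 1) - xstar‖ ^ 2
        - (((t k) ^ 2 - t k) / (t (k - 1)) ^ 2)
            * ((-(t k) ^ 2 + t k + (t (k - 1)) ^ 2) / (t (k - 1)) ^ 2) * ‖η k‖ ^ 2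
        + ((-(t k) ^ 2 + t k + (t (k - 1)) ^ 2) / (t (k - 1)) ^ 2) * ‖xstar‖ ^ 2 := by
  intro k hk
  have hge := one_le_of_pred_lt ht0 fun k hk => (hT k hk).1
  have hs : t (k - 1) ≠ 0 := (zero_lt_one.trans_le (hge _)).ne'
  have ht : t k ≠ 0 := (zero_lt_one.trans_le (hge _)).ne'
  have hu : t (k + 1) ≠ 0 := (zero_lt_one.trans_le (hge _)).ne'
  have ht1 : t k - 1 ≠ 0 := (sub_pos.2 ((hge _).trans_lt (hT k hk).1)).ne'
  have hu1 : t (k + 1) - 1 ≠ 0 :=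
    (sub_pos.2 ((hge _).trans_lt (hT (k + 1) k.succ_pos).1)).ne'
  have he' : η (k + 1) = t k • x (k + 1) - (t k - 1) • x k := by
    rw [hη (k + 1) k.succ_pos, hy (k + 1) k.succ_pos, Nat.add_sub_cancel]
    exact eta_eq_extrapolation ht hu hu1 _ _
  have he : t k • y k - (t k - 1) • x k = (((t k) ^ 2 - t k) / (t (k - 1)) ^ 2) • η k := by
    rw [hη k hk]
    match_scalars <;> field_simp
  have ha : (-(t k) ^ 2 + t k + (t (k - 1)) ^ 2) / (t (k - 1)) ^ 2
      = 1 - ((t k) ^ 2 - t k) / (t (k - 1)) ^ 2 := by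
    field_simp
    ring
  rw [ha]
  exact inner_extrapolation_eq he he' xstar
end

section
/- Let (t_k)_{k≥0} satisfy condition (T), let 0 < s < 1/L, and let (x_k), (y_k) be generated by (TIREPROG). Let k₀ ∈ ℕ be such that s ≤ 1/(L + ε_{k₀}). Assume that liminf_{k→∞} (−t_k² + t_k + t_{k−1}²)/t_k > 0, that the sequence (t_k² ε_k)_{k≥k₀−1} is increasing, that lim_{k→∞} t_k² ε_k = +∞, and that lim_{k→∞} t_k(ε_k − ε_{k+1})/ε_k = 0. For k ≥ 1 define η_k = (t_{k−1}²/(t_k − 1)) y_k − (t_{k−1}²/t_k) x_k and the energy E_k = 2s t_{k−1}² (F_k(x_k) − F_k(x̄_k)) + ‖η_k − x*‖². Then E_{n+1}/(t_n² ε_n) → 0 as n → +∞. -/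
open Filter Topology
open scoped RealInnerProductSpace

/-- The derivative of a function with a gradient along a line. -/
theorem hasDerivAt_gradient_line {H : Type*} [NormedAddCommGroup H] [InnerProductSpace ℝ H]
    [CompleteSpace H] {g : H → ℝ} {g' : H → H} (hd : ∀ u, HasGradientAt g (g' u) u)
    (u d : H) (r : ℝ) :
    HasDerivAt (fun r : ℝ => g (u + r • d)) ⟪g' (u + r • d), d⟫ r := by
  have hline : HasDerivAt (fun r : ℝ => u + r • d) d r := by
    simpa using ((hasDerivAt_id r).smul_const d).const_add u
  exact ((hd (u + r • d)).hasFDerivAt).comp_hasDerivAt r hline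

/-- First-order characterization of convexity. -/
theorem convex_gradient_inequality {H : Type*} [NormedAddCommGroup H] [InnerProductSpace ℝ H]
    [CompleteSpace H] {g : H → ℝ} {g' : H → H} (hg : ConvexOn ℝ Set.univ g)
    (hd : ∀ u, HasGradientAt g (g' u) u) (u v : H) :
    g u + ⟪g' u, v - u⟫ ≤ g v := by
  have hder : HasDerivAt (fun r : ℝ => g (u + r • (v - u))) ⟪g' u, v - u⟫ 0 := by
    simpa using hasDerivAt_gradient_line hd u (v - u) 0
  have hconv : ConvexOn ℝ Set.univ (fun r : ℝ => g (u + r • (v - u))) := by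
    have h := hg.comp_affineMap (AffineMap.lineMap (k := ℝ) u v)
    refine (by simpa using h : ConvexOn ℝ Set.univ (g ∘ AffineMap.lineMap (k := ℝ) u v)).congr ?_
    intro r _
    simp [AffineMap.lineMap_apply, add_comm]
  have h := hconv.le_slope_of_hasDerivAt (Set.mem_univ 0) (Set.mem_univ 1) one_pos hder
  simp [slope_def_field] at h
  linarith

/-- The descent lemma for functions with Lipschitz gradient. -/
theorem descent_inequality {H : Type*} [NormedAddCommGroup H] [InnerProductSpace ℝ H]
    [CompleteSpace H] {g : H → ℝ} {g' : H → H} {L : ℝ}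
    (hd : ∀ u, HasGradientAt g (g' u) u) (hlip : ∀ u v, ‖g' u - g' v‖ ≤ L * ‖u - v‖) (u v : H) :
    g v ≤ g u + ⟪g' u, v - u⟫ + L / 2 * ‖v - u‖ ^ 2 := by
  have hder : ∀ r : ℝ, HasDerivAt
      (fun r : ℝ => g (u + r • (v - u)) - (r * ⟪g' u, v - u⟫ + L / 2 * r ^ 2 * ‖v - u‖ ^ 2))
      (⟪g' (u + r • (v - u)), v - u⟫ - (⟪g' u, v - u⟫ + L * r * ‖v - u‖ ^ 2)) r := fun r => by
    have h2 : HasDerivAt (fun r : ℝ => r * ⟪g' u, v - u⟫ + L / 2 * r ^ 2 * ‖v - u‖ ^ 2)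
        (⟪g' u, v - u⟫ + L * r * ‖v - u‖ ^ 2) r := by
      refine (((hasDerivAt_id r).mul_const ⟪g' u, v - u⟫).add
        ((((hasDerivAt_id r).pow 2).const_mul (L / 2)).mul_const (‖v - u‖ ^ 2))).congr_deriv ?_
      simp only [one_mul, mul_one, id_eq, Nat.cast_ofNat, Nat.add_one_sub_one, pow_one]
      ring
    exact (hasDerivAt_gradient_line hd u (v - u) r).sub h2
  have hanti := antitoneOn_of_deriv_nonpos (convex_Icc (0 : ℝ) 1)
    (fun r _ => (hder r).continuousAt.continuousWithinAt)
    (fun r _ => (hder r).differentiableAt.differentiableWithinAt)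
    (fun r hr => by
      rw [interior_Icc] at hr
      rw [(hder r).deriv]
      have h1 : ⟪g' (u + r • (v - u)) - g' u, v - u⟫ ≤ L * (r * ‖v - u‖) * ‖v - u‖ := by
        refine (real_inner_le_norm _ _).trans (mul_le_mul_of_nonneg_right ?_ (norm_nonneg _))
        refine (hlip _ _).trans_eq ?_
        rw [add_sub_cancel_left, norm_smul, Real.norm_of_nonneg hr.1.le]
      rw [inner_sub_left] at h1
      nlinarith)
  have h := hanti (Set.left_mem_Icc.2 zero_le_one) (Set.right_mem_Icc.2 zero_le_one) zero_le_one
  simp at h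
  linarith

/-- A minimizer of a convex function plus a quadratic satisfies a quadratic growth inequality. -/
theorem quadratic_growth_of_minimizer {H : Type*} [NormedAddCommGroup H] [InnerProductSpace ℝ H]
    {D : Set H} {h : H → ℝ} (hh : ConvexOn ℝ D h) {c : ℝ} {w z u : H} (hz : z ∈ D)
    (hmin : ∀ v ∈ D, h z + c * ‖z - w‖ ^ 2 ≤ h v + c * ‖v - w‖ ^ 2) (hu : u ∈ D) :
    h z + c * ‖z - w‖ ^ 2 + c * ‖u - z‖ ^ 2 ≤ h u + c * ‖u - w‖ ^ 2 := by
  have key : ∀ r : ℝ, 0 < r → r < 1 →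
      h z + c * ‖z - w‖ ^ 2 + (1 - r) * (c * ‖u - z‖ ^ 2) ≤ h u + c * ‖u - w‖ ^ 2 := by
    intro r hr hr1
    have h1 := hmin _ (hh.1 hz hu (by linarith : 0 ≤ 1 - r) hr.le (by ring))
    have h2 := hh.2 hz hu (by linarith : 0 ≤ 1 - r) hr.le (by ring)
    have h3 : ‖(1 - r) • z + r • u - w‖ ^ 2
        = (1 - r) * ‖z - w‖ ^ 2 + r * ‖u - w‖ ^ 2 - r * (1 - r) * ‖u - z‖ ^ 2 := by
      have e1 : (1 - r) • z + r • u - w = (1 - r) • (z - w) + r • (u - w) := by module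
      have e2 : u - z = (u - w) - (z - w) := by abel
      rw [e1, e2, norm_add_sq_real, norm_sub_sq_real (u - w), norm_smul, norm_smul,
        real_inner_smul_left, real_inner_smul_right, Real.norm_of_nonneg hr.le,
        Real.norm_of_nonneg (by linarith : 0 ≤ 1 - r), real_inner_comm (z - w) (u - w)]
      ring
    rw [h3] at h1
    simp only [smul_eq_mul] at h2
    have h4 : r * (h z + c * ‖z - w‖ ^ 2 + (1 - r) * (c * ‖u - z‖ ^ 2))
        ≤ r * (h u + c * ‖u - w‖ ^ 2) := by linarith
    exact le_of_mul_le_mul_left h4 hr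
  have hlim : Tendsto (fun r : ℝ => h z + c * ‖z - w‖ ^ 2 + (1 - r) * (c * ‖u - z‖ ^ 2))
      (𝓝[>] 0) (𝓝 (h z + c * ‖z - w‖ ^ 2 + (1 - 0) * (c * ‖u - z‖ ^ 2))) :=
    (Continuous.tendsto (by fun_prop) 0).mono_left nhdsWithin_le_nhds
  rw [sub_zero, one_mul] at hlim
  refine le_of_tendsto hlim ?_
  filter_upwards [Ioo_mem_nhdsGT (zero_lt_one' ℝ)] with r hr using key r hr.1 hr.2

/-- The fundamental inequality of one proximal-gradient step on the Tikhonov-regularized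
objective. -/
theorem forward_backward_inequality {H : Type*} [NormedAddCommGroup H] [InnerProductSpace ℝ H]
    [CompleteSpace H] {D : Set H} {h g : H → ℝ} {g' : H → H} {L s e : ℝ}
    (hh : ConvexOn ℝ D h) (hg : ConvexOn ℝ Set.univ g) (hd : ∀ u, HasGradientAt g (g' u) u)
    (hlip : ∀ u v, ‖g' u - g' v‖ ≤ L * ‖u - v‖) (hs : 0 < s) (he : 0 ≤ e) (hse : s * (L + e) ≤ 1)
    {y z u : H} (hz : z ∈ D)
    (hmin : ∀ v ∈ D, h z + 1 / (2 * s) * ‖z - (y - s • g' y - (s * e) • y)‖ ^ 2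
      ≤ h v + 1 / (2 * s) * ‖v - (y - s • g' y - (s * e) • y)‖ ^ 2) (hu : u ∈ D) :
    2 * s * (h z + g z + e / 2 * ‖z‖ ^ 2) + ‖z - u‖ ^ 2
      ≤ 2 * s * (h u + g u + e / 2 * ‖u‖ ^ 2) + ‖y - u‖ ^ 2 := by
  have h1 := quadratic_growth_of_minimizer hh hz hmin hu
  have h2 := descent_inequality hd hlip y z
  have h3 := convex_gradient_inequality hg hd y u
  have h4 : 2 * s * h z + ‖z - (y - s • g' y - (s * e) • y)‖ ^ 2 + ‖u - z‖ ^ 2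
      ≤ 2 * s * h u + ‖u - (y - s • g' y - (s * e) • y)‖ ^ 2 := by
    have := mul_le_mul_of_nonneg_left h1 (by positivity : 0 ≤ 2 * s)
    field_simp at this
    linarith
  have expand : ∀ v : H, ‖v - (y - s • g' y - (s * e) • y)‖ ^ 2 = ‖v - y‖ ^ 2
      + 2 * s * ⟪g' y, v - y⟫ + 2 * s * e * ⟪y, v - y⟫ + ‖s • g' y + (s * e) • y‖ ^ 2 := by
    intro v
    have e1 : v - (y - s • g' y - (s * e) • y) = (v - y) + (s • g' y + (s * e) • y) := by abel
    rw [e1, norm_add_sq_real, inner_add_right, inner_smul_right, inner_smul_right,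
      real_inner_comm (g' y), real_inner_comm y]
    ring
  have norms : ∀ v : H, ‖v‖ ^ 2 = ‖y‖ ^ 2 + 2 * ⟪y, v - y⟫ + ‖v - y‖ ^ 2 := by
    intro v
    conv_lhs => rw [← add_sub_cancel y v]
    exact norm_add_sq_real _ _
  rw [expand, expand] at h4
  rw [norms z, norms u, norm_sub_rev z u, norm_sub_rev y u]
  have h5 : s * (L + e) * ‖z - y‖ ^ 2 ≤ ‖z - y‖ ^ 2 :=
    mul_le_of_le_one_left (sq_nonneg _) hse
  have h6 : 0 ≤ s * e * ‖u - y‖ ^ 2 := by positivity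
  have h7 := mul_le_mul_of_nonneg_left h2 (by positivity : 0 ≤ 2 * s)
  have h8 := mul_le_mul_of_nonneg_left h3 (by positivity : 0 ≤ 2 * s)
  linarith

/-- One-step decrease of the discrete energy. -/
theorem energy_step {H : Type*} [NormedAddCommGroup H] [InnerProductSpace ℝ H]
    {D : Set H} {Φ : H → ℝ} (hΦ : ConvexOn ℝ D Φ) {x y z p η : H} {s t τ θ m : ℝ}
    (hs : 0 < s) (ht : 1 ≤ t) (hθ0 : 0 ≤ θ) (hθ1 : θ ≤ 1) (hθ : τ ^ 2 * (1 - θ) = t ^ 2 - t)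
    (hx : x ∈ D) (hp : p ∈ D) (hy : t • y - (t - 1) • x = (1 - θ) • η)
    (hstep : ∀ u ∈ D, 2 * s * Φ z + ‖z - u‖ ^ 2 ≤ 2 * s * Φ u + ‖y - u‖ ^ 2) :
    2 * s * t ^ 2 * (Φ z - m) + ‖t • z - (t - 1) • x - p‖ ^ 2
      ≤ (1 - θ) * (2 * s * τ ^ 2 * (Φ x - m) + ‖η - p‖ ^ 2)
        + (2 * s * t * (Φ p - m) + θ * ‖p‖ ^ 2) := by
  have ht0 : 0 < t := by linarith
  have ha : 0 ≤ 1 - 1 / t := by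
    rw [sub_nonneg, div_le_one ht0]; exact ht
  have hb : 0 ≤ 1 / t := by positivity
  have h1 := hstep _ (hΦ.1 hx hp ha hb (by ring))
  have h2 := hΦ.2 hx hp ha hb (by ring)
  have hsq : ∀ v : H, t ^ 2 * ‖v - ((1 - 1 / t) • x + (1 / t) • p)‖ ^ 2
      = ‖t • v - (t - 1) • x - p‖ ^ 2 := by
    intro v
    rw [← Real.norm_of_nonneg ht0.le, ← mul_pow, ← norm_smul, Real.norm_of_nonneg ht0.le]
    congr 2
    match_scalars <;> field_simp
  have h3 := mul_le_mul_of_nonneg_left h1 (sq_nonneg t)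
  rw [mul_add, mul_add, hsq, hsq, hy] at h3
  have h4 := mul_le_mul_of_nonneg_left h2 (by positivity : 0 ≤ 2 * s * t ^ 2)
  have h5 : 2 * s * t ^ 2 * ((1 - 1 / t) • Φ x + (1 / t) • Φ p)
      = 2 * s * (t ^ 2 - t) * Φ x + 2 * s * t * Φ p := by
    simp only [smul_eq_mul]; field_simp
  rw [h5] at h4
  have h6 : ‖(1 - θ) • η - p‖ ^ 2 ≤ (1 - θ) * ‖η - p‖ ^ 2 + θ * ‖p‖ ^ 2 := by
    have e1 : (1 - θ) • η - p = (1 - θ) • (η - p) + θ • (-p) := by module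
    have h7 := (convexOn_univ_norm.pow (fun _ _ => norm_nonneg _) 2).2 (Set.mem_univ (η - p))
      (Set.mem_univ (-p)) (by linarith : 0 ≤ 1 - θ) hθ0 (by ring)
    rw [e1]
    simpa using h7
  have h8 : (1 - θ) * (2 * s * τ ^ 2 * (Φ x - m)) = 2 * s * (t ^ 2 - t) * (Φ x - m) := by
    rw [← hθ]; ring
  nlinarith

/-- A nonnegative sequence driven by a contraction with non-summable gaps and a vanishing
perturbation tends to zero. -/
theorem tendsto_zero_of_contraction {R θ c : ℕ → ℝ} {δ : ℝ} (hδ : 0 < δ) {N : ℕ}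
    (hR : ∀ k ≥ N, 0 ≤ R k) (hθ : ∀ k ≥ N, δ / (k + 1) ≤ θ k) (hθ1 : ∀ k ≥ N, θ k ≤ 1)
    (hc : Tendsto c atTop (𝓝 0))
    (hrec : ∀ k ≥ N, R (k + 1) ≤ (1 - θ k) * R k + θ k * c k) :
    Tendsto R atTop (𝓝 0) := by
  rw [Metric.tendsto_atTop]
  intro e he
  obtain ⟨M, hM⟩ := eventually_atTop.1
    ((hc.eventually_le_const (half_pos he)).and (eventually_ge_atTop N))
  have hMN : N ≤ M := (hM M le_rfl).2
  set S : ℕ → ℝ := fun n => ∑ i ∈ Finset.range n, 1 / ((i : ℝ) + 1) with hS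
  have hbound : ∀ n ≥ M, R n - e / 2 ≤ R M * Real.exp (-(δ * (S n - S M))) := by
    intro n hn
    induction n, hn using Nat.le_induction with
    | base => simp; linarith
    | succ n hn ih =>
      have hnN := hMN.trans hn
      have h1 := hrec n hnN
      have h2 := mul_le_mul_of_nonneg_left (hM n hn).1
        ((by positivity : (0 : ℝ) ≤ δ / (n + 1)).trans (hθ n hnN))
      have h3 := mul_le_mul_of_nonneg_left ih (by linarith [hθ1 n hnN] : 0 ≤ 1 - θ n)
      have h4 : 1 - θ n ≤ Real.exp (-(δ / (n + 1))) := by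
        linarith [hθ n hnN, Real.add_one_le_exp (-(δ / ((n : ℝ) + 1)))]
      have h5 := mul_le_mul_of_nonneg_right h4
        (mul_nonneg (hR M hMN) (Real.exp_pos (-(δ * (S n - S M)))).le)
      have h6 : Real.exp (-(δ * (S (n + 1) - S M)))
          = Real.exp (-(δ / (n + 1))) * Real.exp (-(δ * (S n - S M))) := by
        rw [← Real.exp_add]
        congr 1
        simp only [hS, Finset.sum_range_succ]
        ring
      rw [h6]
      linarith
  have hlim : Tendsto (fun n => R M * Real.exp (-(δ * (S n - S M)))) atTop (𝓝 0) := by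
    have h1 : Tendsto (fun n => δ * (S n - S M)) atTop atTop :=
      (tendsto_atTop_add_const_right _ _
        Real.tendsto_sum_range_one_div_nat_succ_atTop).const_mul_atTop hδ
    simpa using (Real.tendsto_exp_neg_atTop_nhds_zero.comp h1).const_mul (R M)
  obtain ⟨K, hK⟩ := eventually_atTop.1 (hlim.eventually_lt_const (half_pos he))
  refine ⟨max M K, fun n hn => ?_⟩
  have hnM := (le_max_left _ _).trans hn
  rw [Real.dist_eq, sub_zero, abs_of_nonneg (hR n (hMN.trans hnM))]
  linarith [hbound n hnM, hK n ((le_max_right _ _).trans hn)]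

/-- A minimizer of a proper extended-real function plus a finite one lies in the domain. -/
theorem toReal_le_of_minimizer {H : Type*} {f : H → EReal} (hp : ∃ z, f z ≠ ⊤)
    (hb : ∀ z, f z ≠ ⊥) {a : H → ℝ} {z : H}
    (hmin : ∀ u, f z + (a z : EReal) ≤ f u + (a u : EReal)) :
    f z ≠ ⊤ ∧ ∀ u, f u ≠ ⊤ → (f z).toReal + a z ≤ (f u).toReal + a u := by
  have hz : f z ≠ ⊤ := by
    obtain ⟨u, hu⟩ := hp
    intro h
    have h1 := hmin u
    rw [h, EReal.top_add_coe, top_le_iff] at h1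
    rw [← EReal.coe_toReal hu (hb u), ← EReal.coe_add] at h1
    exact EReal.coe_ne_top _ h1
  refine ⟨hz, fun u hu => ?_⟩
  have h1 := hmin u
  rw [← EReal.coe_toReal hu (hb u), ← EReal.coe_toReal hz (hb z)] at h1
  exact_mod_cast h1

/-- A minimizer of the Tikhonov-regularized function is no larger in norm than any minimizer of
the original one. -/
theorem tikhonov_norm_le {H : Type*} [NormedAddCommGroup H] {D : Set H} {φ : H → ℝ}
    {p z : H} {e : ℝ} (he : 0 < e) (hp : p ∈ D) (hz : z ∈ D) (hpmin : ∀ u ∈ D, φ p ≤ φ u)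
    (hzmin : ∀ u ∈ D, φ z + e / 2 * ‖z‖ ^ 2 ≤ φ u + e / 2 * ‖u‖ ^ 2) : ‖z‖ ≤ ‖p‖ := by
  have h1 := hpmin z hz
  have h2 := hzmin p hp
  have h3 : e / 2 * ‖z‖ ^ 2 ≤ e / 2 * ‖p‖ ^ 2 := by linarith
  exact (sq_le_sq₀ (norm_nonneg _) (norm_nonneg _)).1 (le_of_mul_le_mul_left h3 (half_pos he))

/-- The norms of the Tikhonov minimizers converge to the minimal norm of a minimizer. -/
theorem tikhonov_norm_tendsto {H : Type*} [NormedAddCommGroup H] [InnerProductSpace ℝ H]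
    [CompleteSpace H] {f : H → EReal} (hb : ∀ z, f z ≠ ⊥) (hlsc : LowerSemicontinuous f)
    {g : H → ℝ} (hg : Continuous g)
    (hconv : ConvexOn ℝ {u | f u ≠ ⊤} (fun u => (f u).toReal + g u))
    {p : H} (hp : f p ≠ ⊤)
    (hpmin : ∀ u, f u ≠ ⊤ → (f p).toReal + g p ≤ (f u).toReal + g u)
    (hpnorm : ∀ u, f u ≠ ⊤ → (f u).toReal + g u ≤ (f p).toReal + g p → ‖p‖ ≤ ‖u‖)
    {e : ℕ → ℝ} (he : ∀ k, 0 < e k) (hanti : Antitone e) (hlim : Tendsto e atTop (𝓝 0))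
    {z : ℕ → H} (hz : ∀ k, f (z k) ≠ ⊤)
    (hzmin : ∀ k u, f u ≠ ⊤ → (f (z k)).toReal + g (z k) + e k / 2 * ‖z k‖ ^ 2
      ≤ (f u).toReal + g u + e k / 2 * ‖u‖ ^ 2) :
    Tendsto (fun k => ‖z k‖) atTop (𝓝 ‖p‖) := by
  have hle : ∀ k, ‖z k‖ ≤ ‖p‖ := fun k =>
    tikhonov_norm_le (D := {u | f u ≠ ⊤}) (φ := fun u => (f u).toReal + g u)
      (he k) hp (hz k) hpmin (hzmin k)
  have hdist : ∀ k j, k ≤ j → ‖z j - z k‖ ^ 2 ≤ ‖z j‖ ^ 2 - ‖z k‖ ^ 2 := by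
    intro k j hkj
    have h1 := quadratic_growth_of_minimizer hconv (c := e k / 2) (w := 0) (hz k)
      (by simpa using hzmin k) (hz j)
    have h2 := hzmin j (z k) (hz k)
    have h3 := hanti hkj
    simp only [sub_zero] at h1
    have h4 : e k * ‖z j - z k‖ ^ 2 ≤ (e k - e j) * (‖z j‖ ^ 2 - ‖z k‖ ^ 2) := by linarith
    have h5 : 0 ≤ e k * ‖z j - z k‖ ^ 2 := mul_nonneg (he k).le (sq_nonneg _)
    rcases h3.eq_or_lt with h6 | h6
    · rw [h6, sub_self, zero_mul] at h4
      have h7 : ‖z j - z k‖ ^ 2 = 0 := by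
        have := he k
        nlinarith [sq_nonneg ‖z j - z k‖]
      have h8 : z j = z k := by simpa [sub_eq_zero] using h7
      simp [h8]
    · have h7 : 0 ≤ ‖z j‖ ^ 2 - ‖z k‖ ^ 2 :=
        nonneg_of_mul_nonneg_right (h5.trans h4) (by linarith)
      have h8 : e k * ‖z j - z k‖ ^ 2 ≤ e k * (‖z j‖ ^ 2 - ‖z k‖ ^ 2) :=
        h4.trans (mul_le_mul_of_nonneg_right (by linarith [he j]) h7)
      exact le_of_mul_le_mul_left h8 (he k)
  have hmono : Monotone (fun k => ‖z k‖ ^ 2) := fun k j hkj => by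
    have := hdist k j hkj
    simp only
    linarith [sq_nonneg ‖z j - z k‖]
  have hbdd : BddAbove (Set.range (fun k => ‖z k‖ ^ 2)) := by
    refine ⟨‖p‖ ^ 2, ?_⟩
    rintro _ ⟨k, rfl⟩
    exact pow_le_pow_left₀ (norm_nonneg _) (hle k) 2
  have hcauchy_sq := (tendsto_atTop_ciSup hmono hbdd).cauchySeq
  have hcauchy : CauchySeq z := by
    rw [Metric.cauchySeq_iff'] at hcauchy_sq ⊢
    intro r hr
    obtain ⟨N, hN⟩ := hcauchy_sq (r ^ 2) (by positivity)
    refine ⟨N, fun n hn => ?_⟩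
    have h1 := (le_abs_self _).trans_lt (Real.dist_eq _ _ ▸ hN n hn)
    rw [dist_eq_norm]
    exact (sq_lt_sq₀ (norm_nonneg _) hr.le).1 ((hdist N n hn).trans_lt h1)
  obtain ⟨q, hq⟩ := cauchySeq_tendsto_of_complete hcauchy
  have hup : ∀ k, f (z k) ≤ (((f p).toReal + g p + e k / 2 * ‖p‖ ^ 2 - g (z k) : ℝ) : EReal) := by
    intro k
    rw [← EReal.coe_toReal (hz k) (hb _), EReal.coe_le_coe_iff]
    have h1 := hzmin k p hp
    have h2 : 0 ≤ e k / 2 * ‖z k‖ ^ 2 := mul_nonneg (half_pos (he k)).le (sq_nonneg _)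
    linarith
  have hup_lim : Tendsto (fun k => (f p).toReal + g p + e k / 2 * ‖p‖ ^ 2 - g (z k)) atTop
      (𝓝 ((f p).toReal + g p - g q)) := by
    have h1 := (((hlim.div_const 2).mul_const (‖p‖ ^ 2)).const_add ((f p).toReal + g p)).sub
      ((hg.tendsto q).comp hq)
    simpa using h1
  have hfq : f q ≤ (((f p).toReal + g p - g q : ℝ) : EReal) := by
    by_contra! hlt
    obtain ⟨r, hr1, hr2⟩ := EReal.lt_iff_exists_real_btwn.1 hlt
    have h1 := hq.eventually (hlsc q r hr2)
    have h2 := hup_lim.eventually_lt_const (EReal.coe_lt_coe_iff.1 hr1)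
    obtain ⟨k, hk1, hk2⟩ := (h1.and h2).exists
    exact absurd (EReal.coe_lt_coe_iff.1 (hk1.trans_le (hup k))) hk2.not_gt
  have hqD : f q ≠ ⊤ := (hfq.trans_lt (EReal.coe_lt_top _)).ne
  have hqle : (f q).toReal + g q ≤ (f p).toReal + g p := by
    rw [← EReal.coe_toReal hqD (hb q), EReal.coe_le_coe_iff] at hfq
    linarith
  have hnorm : ‖p‖ = ‖q‖ :=
    le_antisymm (hpnorm q hqD hqle) (le_of_tendsto' hq.norm hle)
  rw [hnorm]
  exact hq.norm

/-- The real part of a convex extended-real function is convex on its domain. -/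
theorem convexOn_toReal {H : Type*} [AddCommGroup H] [Module ℝ H] {f : H → EReal}
    (hb : ∀ z, f z ≠ ⊥)
    (hf : ∀ u v : H, ∀ a b : ℝ, 0 ≤ a → 0 ≤ b → a + b = 1 →
      f (a • u + b • v) ≤ (a : EReal) * f u + (b : EReal) * f v) :
    ConvexOn ℝ {u | f u ≠ ⊤} (fun u => (f u).toReal) := by
  have key : ∀ u v : H, f u ≠ ⊤ → f v ≠ ⊤ → ∀ a b : ℝ, 0 ≤ a → 0 ≤ b → a + b = 1 →
      f (a • u + b • v) ≤ ((a * (f u).toReal + b * (f v).toReal : ℝ) : EReal) := by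
    intro u v hu hv a b ha hb' hab
    have h := hf u v a b ha hb' hab
    rw [← EReal.coe_toReal hu (hb u), ← EReal.coe_toReal hv (hb v)] at h
    exact_mod_cast h
  refine ⟨fun u hu v hv a b ha hb' hab => ?_, fun u hu v hv a b ha hb' hab => ?_⟩
  · exact ((key u v hu hv a b ha hb' hab).trans_lt (EReal.coe_lt_top _)).ne
  · have h := key u v hu hv a b ha hb' hab
    have htop := (h.trans_lt (EReal.coe_lt_top _)).ne
    rw [← EReal.coe_toReal htop (hb _), EReal.coe_le_coe_iff] at h
    exact h

theorem tireprog_energy_rate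
    {H : Type*} [NormedAddCommGroup H] [InnerProductSpace ℝ H] [CompleteSpace H]
    (f : H → EReal) (g : H → ℝ) (g' : H → H) (L : ℝ) (hL : 0 < L)
    -- f is proper, convex and lower semicontinuous
    (hf_proper : ∃ z, f z ≠ ⊤) (hf_nebot : ∀ z, f z ≠ ⊥)
    (hf_convex : ∀ u v : H, ∀ a b : ℝ, 0 ≤ a → 0 ≤ b → a + b = 1 →
      f (a • u + b • v) ≤ (a : EReal) * f u + (b : EReal) * f v)
    (hf_lsc : LowerSemicontinuous f)
    -- g is convex, differentiable with L-Lipschitz gradient g'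
    (hg_convex : ConvexOn ℝ Set.univ g)
    (hg_diff : ∀ u : H, HasGradientAt g (g' u) u)
    (hg_lip : ∀ u v : H, ‖g' u - g' v‖ ≤ L * ‖u - v‖)
    -- prox_{σ f} is a minimizer of u ↦ f(u) + ‖u − z‖²/(2σ)
    (prox : ℝ → H → H)
    (hprox : ∀ σ : ℝ, 0 < σ → ∀ z u : H,
      f (prox σ z) + ((‖prox σ z - z‖ ^ 2 / (2 * σ) : ℝ) : EReal)
        ≤ f u + ((‖u - z‖ ^ 2 / (2 * σ) : ℝ) : EReal))
    -- the sequence (t_k) satisfies condition (T)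
    (t : ℕ → ℝ) (ht0 : t 0 = 1)
    (hT : ∀ k : ℕ, 1 ≤ k →
      t (k - 1) < t k ∧ t k < (1 + Real.sqrt (1 + 4 * t (k - 1) ^ 2)) / 2)
    -- (ε_k) is a nonincreasing sequence of positive reals tending to 0
    (ε : ℕ → ℝ) (hε_pos : ∀ k : ℕ, 1 ≤ k → 0 < ε k)
    (hε_anti : ∀ k : ℕ, 1 ≤ k → ε (k + 1) ≤ ε k)
    (hε_lim : Tendsto ε atTop (nhds (0 : ℝ)))
    -- the stepsize
    (s : ℝ) (hs_pos : 0 < s) (hs_lt : s < 1 / L)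
    -- the algorithm (TIREPROG)
    (x y : ℕ → H)
    (hy : ∀ k : ℕ, 1 ≤ k → y k = x k
        + (((t k - 1) * (t (k - 1) - 1)) / (t (k - 1)) ^ 2) • (x k - x (k - 1))
        - (((-(t k) ^ 2 + t k + (t (k - 1)) ^ 2) / ((t (k - 1)) ^ 2 * t k))) • x k)
    (hx : ∀ k : ℕ, 1 ≤ k →
      x (k + 1) = prox s (y k - s • g' (y k) - (s * ε k) • y k))
    -- x* is the minimum norm element of argmin (f + g)
    (xstar : H)
    (hxstar_min : ∀ u : H, f xstar + (g xstar : EReal) ≤ f u + (g u : EReal))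
    (hxstar_norm : ∀ u : H,
      (∀ v : H, f u + (g u : EReal) ≤ f v + (g v : EReal)) → ‖xstar‖ ≤ ‖u‖)
    -- k₀ with s ≤ 1/(L + ε_{k₀})
    (k₀ : ℕ) (hk₀ : s ≤ 1 / (L + ε k₀))
    -- the hypotheses on the parameters
    (hliminf : 0 < atTop.liminf (fun k : ℕ => (-(t k) ^ 2 + t k + (t (k - 1)) ^ 2) / t k))
    (hincr : ∀ k : ℕ, k₀ - 1 ≤ k → (t k) ^ 2 * ε k < (t (k + 1)) ^ 2 * ε (k + 1))
    (htε_top : Tendsto (fun k : ℕ => (t k) ^ 2 * ε k) atTop atTop)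
    (hratio : Tendsto (fun k : ℕ => t k * (ε k - ε (k + 1)) / ε k) atTop (nhds (0 : ℝ)))
    -- F_k(x) = f(x) + g(x) + (ε_k/2)‖x‖² and its unique minimizer x̄_k
    (F : ℕ → H → EReal)
    (hF : ∀ (k : ℕ) (u : H), F k u = f u + (g u : EReal) + ((ε k / 2 * ‖u‖ ^ 2 : ℝ) : EReal))
    (xbar : ℕ → H)
    (hxbar : ∀ (k : ℕ) (u : H), F k (xbar k) ≤ F k u)
    -- the sequences η_k and the energy E_k
    (η : ℕ → H)
    (hη : ∀ k : ℕ, 1 ≤ k →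
      η k = ((t (k - 1)) ^ 2 / (t k - 1)) • y k - ((t (k - 1)) ^ 2 / t k) • x k)
    (E : ℕ → EReal)
    (hE : ∀ k : ℕ, 1 ≤ k →
      E k = ((2 * s * (t (k - 1)) ^ 2 : ℝ) : EReal) * (F k (x k) - F k (xbar k))
        + ((‖η k - xstar‖ ^ 2 : ℝ) : EReal))
 :
    Tendsto (fun n : ℕ => E (n + 1) / (((t n) ^ 2 * ε n : ℝ) : EReal))
      atTop (nhds (0 : EReal)) := by
  obtain ⟨δ, hδ, hδt⟩ : ∃ δ > 0, ∀ᶠ k : ℕ in atTop,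
      δ ≤ (-(t k) ^ 2 + t k + (t (k - 1)) ^ 2) / t k := by
    rw [Filter.liminf_eq] at hliminf
    have hne : {a : ℝ | ∀ᶠ k : ℕ in atTop,
        a ≤ (-(t k) ^ 2 + t k + (t (k - 1)) ^ 2) / t k}.Nonempty := by
      by_contra h
      rw [Set.not_nonempty_iff_eq_empty] at h
      rw [h, Real.sSup_empty] at hliminf
      exact lt_irrefl _ hliminf
    obtain ⟨δ, h1, h2⟩ := exists_lt_of_lt_csSup hne hliminf
    exact ⟨δ, h2, h1⟩
  -- elementary properties of `t`
  have ht_lt : ∀ k, t k < t (k + 1) := fun k => by simpa using (hT (k + 1) (by omega)).1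
  have ht_ge : ∀ k, 1 ≤ t k := by
    intro k
    induction k with
    | zero => exact ht0.ge
    | succ k ih => linarith [ht_lt k]
  have ht_root : ∀ k, t (k + 1) < (1 + Real.sqrt (1 + 4 * t k ^ 2)) / 2 := fun k => by
    simpa using (hT (k + 1) (by omega)).2
  have ht_sq : ∀ k, 0 < -(t (k + 1)) ^ 2 + t (k + 1) + t k ^ 2 := by
    intro k
    have h1 := ht_root k
    have h2 := Real.sq_sqrt (by positivity : 0 ≤ 1 + 4 * t k ^ 2)
    nlinarith [ht_ge (k + 1), Real.sqrt_nonneg (1 + 4 * t k ^ 2)]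
  have ht_le : ∀ k : ℕ, t k ≤ k + 1 := by
    intro k
    induction k with
    | zero => simp [ht0]
    | succ k ih =>
      have h1 := ht_ge k
      have h2 : t (k + 1) ≤ t k + 1 := by nlinarith [ht_sq k, ht_ge (k + 1)]
      push_cast
      linarith
  -- passage to real-valued data on the domain of `f`
  have hxs := toReal_le_of_minimizer hf_proper hf_nebot hxstar_min
  have hh : ConvexOn ℝ {u | f u ≠ ⊤} (fun u => (f u).toReal) := convexOn_toReal hf_nebot hf_convex
  have hxbar' : ∀ k, f (xbar k) ≠ ⊤ ∧ ∀ u, f u ≠ ⊤ →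
      (f (xbar k)).toReal + (g (xbar k) + ε k / 2 * ‖xbar k‖ ^ 2)
        ≤ (f u).toReal + (g u + ε k / 2 * ‖u‖ ^ 2) := fun k =>
    toReal_le_of_minimizer (a := fun u => g u + ε k / 2 * ‖u‖ ^ 2) hf_proper hf_nebot fun u => by
      simpa only [hF, add_assoc, EReal.coe_add] using hxbar k u
  have hx' : ∀ k, 1 ≤ k → f (x (k + 1)) ≠ ⊤ ∧ ∀ u, f u ≠ ⊤ → (f (x (k + 1))).toReal
      + ‖x (k + 1) - (y k - s • g' (y k) - (s * ε k) • y k)‖ ^ 2 / (2 * s)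
        ≤ (f u).toReal + ‖u - (y k - s • g' (y k) - (s * ε k) • y k)‖ ^ 2 / (2 * s) := fun k hk =>
    toReal_le_of_minimizer
      (a := fun u => ‖u - (y k - s • g' (y k) - (s * ε k) • y k)‖ ^ 2 / (2 * s))
      hf_proper hf_nebot fun u => by rw [hx k hk]; exact hprox s hs_pos _ u
  set Φ : ℕ → H → ℝ := fun k u => (f u).toReal + g u + ε k / 2 * ‖u‖ ^ 2 with hΦ_def
  have hFΦ : ∀ k u, f u ≠ ⊤ → F k u = (Φ k u : EReal) := fun k u hu => by
    rw [hF, hΦ_def, EReal.coe_add, EReal.coe_add, EReal.coe_toReal hu (hf_nebot u)]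
  have hφ : ConvexOn ℝ {u | f u ≠ ⊤} (fun u => (f u).toReal + g u) :=
    hh.add (hg_convex.subset (Set.subset_univ _) hh.1)
  have hΦ : ∀ k, 1 ≤ k → ConvexOn ℝ {u | f u ≠ ⊤} (Φ k) := fun k hk =>
    hφ.add (((convexOn_norm hh.1).pow (fun _ _ => norm_nonneg _) 2).smul
      (half_pos (hε_pos k hk)).le)
  have hbar_min : ∀ k u, f u ≠ ⊤ → Φ k (xbar k) ≤ Φ k u := fun k u hu => by
    have := (hxbar' k).2 u hu
    simp only [hΦ_def]
    linarith
  have hbar_norm : ∀ k, 1 ≤ k → ‖xbar k‖ ≤ ‖xstar‖ := fun k hk =>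
    tikhonov_norm_le (D := {u | f u ≠ ⊤}) (φ := fun u => (f u).toReal + g u)
      (hε_pos k hk) hxs.1 (hxbar' k).1 hxs.2 (hbar_min k)
  have hg_cont : Continuous g :=
    continuous_iff_continuousAt.2 fun u => (hg_diff u).hasFDerivAt.continuousAt
  have hbar_lim : Tendsto (fun k => ‖xbar (k + 1)‖) atTop (𝓝 ‖xstar‖) := by
    refine tikhonov_norm_tendsto hf_nebot hf_lsc hg_cont hφ hxs.1 hxs.2 ?_
      (e := fun k => ε (k + 1)) (fun k => hε_pos _ (by omega))
      (antitone_nat_of_succ_le fun k => hε_anti _ (by omega))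
      (hε_lim.comp (tendsto_add_atTop_nat 1)) (fun k => (hxbar' _).1)
      (fun k => hbar_min (k + 1))
    intro u hu hle
    refine hxstar_norm u fun v => le_trans ?_ (hxstar_min v)
    rw [← EReal.coe_toReal hu (hf_nebot u), ← EReal.coe_toReal hxs.1 (hf_nebot xstar)]
    exact_mod_cast hle
  -- the real-valued energy
  set e : ℕ → ℝ := fun k => 2 * s * t k ^ 2 * (Φ (k + 1) (x (k + 1)) - Φ (k + 1) (xbar (k + 1)))
    + ‖η (k + 1) - xstar‖ ^ 2 with he_def
  have hEe : ∀ k, 1 ≤ k → E (k + 1) = (e k : EReal) := fun k hk => by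
    rw [hE (k + 1) (by omega), Nat.add_sub_cancel, hFΦ _ _ (hx' k hk).1, hFΦ _ _ (hxbar' _).1,
      he_def]
    push_cast
    rfl
  have he_nonneg : ∀ k, 1 ≤ k → 0 ≤ e k := fun k hk => by
    have h1 := hbar_min (k + 1) _ (hx' k hk).1
    have h2 : 0 ≤ 2 * s * t k ^ 2 := by positivity
    have h3 := mul_nonneg h2 (sub_nonneg.2 h1)
    simp only [he_def]
    positivity
  have hη_eq : ∀ k, η (k + 1) = t k • x (k + 1) - (t k - 1) • x k := fun k => by
    have h1 : t k ≠ 0 := by linarith [ht_ge k]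
    have h2 : t (k + 1) ≠ 0 := by linarith [ht_ge (k + 1)]
    have h3 : t (k + 1) - 1 ≠ 0 := by linarith [ht_ge k, ht_lt k]
    rw [hη (k + 1) (by omega), hy (k + 1) (by omega), Nat.add_sub_cancel]
    match_scalars <;> field_simp
    ring
  set θ : ℕ → ℝ := fun k => (-(t (k + 1)) ^ 2 + t (k + 1) + t k ^ 2) / t k ^ 2 with hθ_def
  have hθ_mul : ∀ k, t k ^ 2 * (1 - θ k) = t (k + 1) ^ 2 - t (k + 1) := fun k => by
    have h1 : t k ≠ 0 := by linarith [ht_ge k]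
    simp only [hθ_def]
    field_simp
    ring
  have hθ_pos : ∀ k, 0 < θ k := fun k => by
    have := ht_ge k
    exact div_pos (ht_sq k) (by positivity)
  have hθ_le : ∀ k, θ k ≤ 1 := fun k => by
    have h1 := ht_ge k
    have h2 := ht_ge (k + 1)
    simp only [hθ_def]
    rw [div_le_one (by positivity)]
    nlinarith
  have hrec : ∀ k, 1 ≤ k → s * (L + ε (k + 1)) ≤ 1 → e (k + 1) ≤ (1 - θ k) * e k
      + (s * t (k + 1) * ε (k + 1) * (‖xstar‖ ^ 2 - ‖xbar (k + 1)‖ ^ 2) + θ k * ‖xstar‖ ^ 2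
        + s * t (k + 1) ^ 2 * (ε (k + 1) - ε (k + 2)) * ‖xstar‖ ^ 2) := by
    intro k hk hsk
    have ha := ht_ge k
    have hb := ht_ge (k + 1)
    have hy_eq : t (k + 1) • y (k + 1) - (t (k + 1) - 1) • x (k + 1) = (1 - θ k) • η (k + 1) := by
      have h1 : t k ≠ 0 := by linarith
      have h2 : t (k + 1) ≠ 0 := by linarith
      have h3 : t (k + 1) - 1 ≠ 0 := by linarith [ht_lt k]
      have h4 : 1 - θ k = (t (k + 1) ^ 2 - t (k + 1)) / t k ^ 2 := by
        rw [← hθ_mul]; field_simp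
      rw [h4, hη (k + 1) (by omega), Nat.add_sub_cancel]
      match_scalars <;> field_simp
    have hstep := energy_step (hΦ (k + 1) (by omega)) (m := Φ (k + 1) (xbar (k + 1))) hs_pos hb
      (hθ_pos k).le (hθ_le k) (hθ_mul k) (hx' k hk).1 hxs.1 hy_eq
      (z := x (k + 2)) (fun u hu =>
        forward_backward_inequality hh hg_convex hg_diff hg_lip hs_pos
          (hε_pos (k + 1) (by omega)).le hsk (hx' (k + 1) (by omega)).1 (fun v hv => by
            have := (hx' (k + 1) (by omega)).2 v hv
            rw [one_div_mul_eq_div, one_div_mul_eq_div]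
            exact this) hu)
    rw [← hη_eq (k + 1)] at hstep
    have h1 : Φ (k + 1) xstar - Φ (k + 1) (xbar (k + 1))
        ≤ ε (k + 1) / 2 * (‖xstar‖ ^ 2 - ‖xbar (k + 1)‖ ^ 2) := by
      have := hxs.2 _ (hxbar' (k + 1)).1
      simp only [hΦ_def]
      linarith
    have h2 : Φ (k + 2) (x (k + 2)) - Φ (k + 2) (xbar (k + 2))
        ≤ Φ (k + 1) (x (k + 2)) - Φ (k + 1) (xbar (k + 1))
          + (ε (k + 1) - ε (k + 2)) / 2 * ‖xstar‖ ^ 2 := by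
      have h3 := hbar_min (k + 1) _ (hxbar' (k + 2)).1
      have h4 := sub_nonneg.2 (hε_anti (k + 1) (by omega))
      have h5 := mul_le_mul_of_nonneg_left
        (pow_le_pow_left₀ (norm_nonneg _) (hbar_norm (k + 2) (by omega)) 2)
        (by linarith : 0 ≤ (ε (k + 1) - ε (k + 2)) / 2)
      have h6 := mul_nonneg h4 (sq_nonneg ‖x (k + 2)‖)
      simp only [hΦ_def] at h3 ⊢
      linarith
    have h3 := mul_le_mul_of_nonneg_left h1 (by positivity : 0 ≤ 2 * s * t (k + 1))
    have h4 := mul_le_mul_of_nonneg_left h2 (by positivity : 0 ≤ 2 * s * t (k + 1) ^ 2)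
    simp only [he_def]
    linarith
  set c : ℕ → ℝ := fun k => s / δ * (‖xstar‖ ^ 2 - ‖xbar (k + 1)‖ ^ 2)
    + ‖xstar‖ ^ 2 / (t (k + 1) ^ 2 * ε (k + 1))
    + s / δ * ‖xstar‖ ^ 2 * (t (k + 1) * (ε (k + 1) - ε (k + 2)) / ε (k + 1)) with hc_def
  have hc : Tendsto c atTop (𝓝 0) := by
    have h1 := ((hbar_lim.pow 2).const_sub (‖xstar‖ ^ 2)).const_mul (s / δ)
    have h2 := ((htε_top.comp (tendsto_add_atTop_nat 1)).const_div_atTop (‖xstar‖ ^ 2))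
    have h3 := (hratio.comp (tendsto_add_atTop_nat 1)).const_mul (s / δ * ‖xstar‖ ^ 2)
    simpa using (h1.add h2).add h3
  have hs_ev : ∀ᶠ k : ℕ in atTop, s * (L + ε (k + 1)) ≤ 1 := by
    have h1 : Tendsto (fun k => s * (L + ε (k + 1))) atTop (𝓝 (s * (L + 0))) :=
      ((hε_lim.comp (tendsto_add_atTop_nat 1)).const_add L).const_mul s
    refine h1.eventually_le_const ?_
    rw [add_zero]
    exact (lt_div_iff₀ hL).1 hs_lt
  obtain ⟨N, hN⟩ := eventually_atTop.1 (hs_ev.and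
    (((tendsto_add_atTop_nat 1).eventually hδt).and (eventually_ge_atTop (k₀ + 1))))
  have hR : Tendsto (fun k => e k / (t k ^ 2 * ε k)) atTop (𝓝 0) := by
    have hD_pos : ∀ k, 1 ≤ k → 0 < t k ^ 2 * ε k := fun k hk => by
      have h1 := ht_ge k
      have h2 := hε_pos k hk
      positivity
    have hθδ : ∀ k ≥ N, δ ≤ θ k * t (k + 1) := by
      intro k hk
      have h1 := (hN k hk).2.1
      rw [Nat.add_sub_cancel] at h1
      have ha := ht_ge k
      have hb := ht_ge (k + 1)
      refine h1.trans ?_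
      simp only [hθ_def]
      rw [div_mul_eq_mul_div, div_le_div_iff₀ (by linarith) (by positivity), mul_assoc]
      refine mul_le_mul_of_nonneg_left ?_ (ht_sq k).le
      nlinarith [ht_lt k]
    refine tendsto_zero_of_contraction (half_pos hδ) (N := N) (θ := θ) (c := c) ?_ ?_
      (fun k _ => hθ_le k) hc ?_
    · intro k hk
      have hk1 : 1 ≤ k := by have := (hN k hk).2.2; omega
      exact div_nonneg (he_nonneg k hk1) (hD_pos k hk1).le
    · intro k hk
      have h1 := hθδ k hk
      have h2 := ht_le (k + 1)
      have h3 := hθ_pos k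
      push_cast at h2
      rw [div_le_iff₀ (by positivity)]
      have h4 := mul_le_mul_of_nonneg_left h2 h3.le
      have h5 : 0 ≤ θ k * (k : ℝ) := by positivity
      linarith
    · intro k hk
      obtain ⟨hsk, -, hk0⟩ := hN k hk
      have hk1 : 1 ≤ k := by omega
      have hb := ht_ge (k + 1)
      have hεk := hε_pos (k + 1) (by omega)
      have hDk := hD_pos (k + 1) (by omega)
      have herr : s * t (k + 1) * ε (k + 1) * (‖xstar‖ ^ 2 - ‖xbar (k + 1)‖ ^ 2)
          + θ k * ‖xstar‖ ^ 2 + s * t (k + 1) ^ 2 * (ε (k + 1) - ε (k + 2)) * ‖xstar‖ ^ 2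
          ≤ t (k + 1) ^ 2 * ε (k + 1) * (θ k * c k) := by
        have h1 : 1 ≤ θ k * t (k + 1) / δ := (one_le_div hδ).2 (hθδ k hk)
        have h2 : 0 ≤ s * t (k + 1) * ε (k + 1) * (‖xstar‖ ^ 2 - ‖xbar (k + 1)‖ ^ 2) :=
          mul_nonneg (by positivity) (sub_nonneg.2
            (pow_le_pow_left₀ (norm_nonneg _) (hbar_norm (k + 1) (by omega)) 2))
        have h3 : 0 ≤ s * t (k + 1) ^ 2 * (ε (k + 1) - ε (k + 2)) * ‖xstar‖ ^ 2 :=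
          mul_nonneg (mul_nonneg (by positivity)
            (sub_nonneg.2 (hε_anti (k + 1) (by omega)))) (sq_nonneg _)
        have h4 : t (k + 1) ^ 2 * ε (k + 1) * (θ k * c k)
            = s * t (k + 1) * ε (k + 1) * (‖xstar‖ ^ 2 - ‖xbar (k + 1)‖ ^ 2)
                * (θ k * t (k + 1) / δ) + θ k * ‖xstar‖ ^ 2
              + s * t (k + 1) ^ 2 * (ε (k + 1) - ε (k + 2)) * ‖xstar‖ ^ 2
                * (θ k * t (k + 1) / δ) := by
          simp only [hc_def]
          field_simp
        rw [h4]
        linarith [le_mul_of_one_le_right h2 h1, le_mul_of_one_le_right h3 h1]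
      have h1 : e k / (t (k + 1) ^ 2 * ε (k + 1)) ≤ e k / (t k ^ 2 * ε k) :=
        div_le_div_of_nonneg_left (he_nonneg k hk1) (hD_pos k hk1) (hincr k (by omega)).le
      have h2 := mul_le_mul_of_nonneg_left h1 (sub_nonneg.2 (hθ_le k))
      refine le_trans ?_ (add_le_add_left h2 _)
      rw [div_le_iff₀ hDk]
      refine ((hrec k hk1 hsk).trans (add_le_add_right herr _)).trans_eq ?_
      field_simp
  have hcoe := (continuous_coe_real_ereal.tendsto 0).comp hR
  refine hcoe.congr' ?_
  filter_upwards [eventually_ge_atTop 1] with k hk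
  rw [hEe k hk, Function.comp_apply, EReal.coe_div]
end
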